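/- arXiv:0804.3008 — 2 statements merged into one kernel-verified Lean document; each statement's English description precedes it below -/
import Mathlib

section
/- Let D, L, E be natural numbers, M = L + E, and let ι : Fin L → Fin M be the canonical inclusion. For a twice continuously differentiable function F : (Fin M → EuclideanSpace ℝ (Fin D)) → ℝ, for i : Fin L and k : Fin M define the first-order differential operator O_{ik} by (O_{ik} F)(x) = (fderiv ℝ F x)(v), where v : Fin M → EuclideanSpace ℝ (Fin D) is the tangent vector equal to x k in slot ι i and 0 in all other slots. Then for all i, j : Fin L, all k, l : Fin M, and every point x, the commutator satisfies (O_{ik}(O_{jl} F))(x) − (O_{jl}(O_{ik} F))(x) = (if ι i = l then (O_{jk} F)(x) else 0) − (if ι j = k then (O_{il} F)(x) else 0). In other words, the IBP operators O_{ik} = ∂/∂l_i · q_k form a closed Lie algebra with commutation relations [O_{ik}, O_{jl}] = δ_{il} O_{jk} − δ_{jk} O_{il}. -/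
/-- The IBP operator `O_{ik} = ∂/∂l_i · q_k`: differentiate `F` at `x` in the
direction of the tangent vector equal to `x k` in slot `ι i` (where
`ι : Fin L → Fin (L+E)` is the canonical inclusion) and `0` elsewhere. -/
noncomputable def ibpOp (D L E : ℕ) (i : Fin L) (k : Fin (L + E))
    (F : (Fin (L + E) → EuclideanSpace ℝ (Fin D)) → ℝ) :
    (Fin (L + E) → EuclideanSpace ℝ (Fin D)) → ℝ :=
  fun x => fderiv ℝ F x (Pi.single (Fin.castAdd E i) (x k))

/-- Product rule for an iterated IBP operator: a second-derivative term plus the term in which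
the coefficient vector field is differentiated. -/
theorem ibpOp_ibpOp (D L E : ℕ)
    (F : (Fin (L + E) → EuclideanSpace ℝ (Fin D)) → ℝ) (i j : Fin L) (k l : Fin (L + E))
    (x : Fin (L + E) → EuclideanSpace ℝ (Fin D))
    (hF : DifferentiableAt ℝ (fderiv ℝ F) x) :
    ibpOp D L E i k (ibpOp D L E j l F) x =
      fderiv ℝ (fderiv ℝ F) x (Pi.single (Fin.castAdd E i) (x k))
          (Pi.single (Fin.castAdd E j) (x l)) +
        (if Fin.castAdd E i = l then ibpOp D L E j k F x else 0) := by
  let c : (Fin (L + E) → EuclideanSpace ℝ (Fin D)) →L[ℝ]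
      (Fin (L + E) → EuclideanSpace ℝ (Fin D)) :=
    (ContinuousLinearMap.single ℝ (fun _ => EuclideanSpace ℝ (Fin D)) (Fin.castAdd E j)).comp
      (ContinuousLinearMap.proj l)
  have h : HasFDerivAt (ibpOp D L E j l F) _ x := hF.hasFDerivAt.clm_apply c.hasFDerivAt
  have hc (y) : c y = Pi.single (Fin.castAdd E j) (y l) := rfl
  rw [ibpOp, h.fderiv]
  simp only [add_apply, ContinuousLinearMap.comp_apply,
    ContinuousLinearMap.flip_apply, hc]
  rw [add_comm]
  congr 1
  split_ifs with hil
  · subst hil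
    simp [ibpOp]
  · rw [Pi.single_eq_of_ne (Ne.symm hil)]
    simp

/-- The IBP operators form a closed Lie algebra:
`[O_{ik}, O_{jl}] = δ_{il} O_{jk} − δ_{jk} O_{il}`. -/
theorem ibp_operators_commutation (D L E : ℕ)
    (F : (Fin (L + E) → EuclideanSpace ℝ (Fin D)) → ℝ)
    (hF : ContDiff ℝ 2 F)
    (i j : Fin L) (k l : Fin (L + E))
    (x : Fin (L + E) → EuclideanSpace ℝ (Fin D)) :
    ibpOp D L E i k (ibpOp D L E j l F) x - ibpOp D L E j l (ibpOp D L E i k F) x =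
      (if Fin.castAdd E i = l then ibpOp D L E j k F x else 0) -
        (if Fin.castAdd E j = k then ibpOp D L E i l F x else 0) := by
  have hd : DifferentiableAt ℝ (fderiv ℝ F) x :=
    (hF.fderiv_right (m := 1) (by norm_num)).differentiable (by norm_num) x
  have hs : IsSymmSndFDerivAt ℝ F x := hF.contDiffAt.isSymmSndFDerivAt (by simp)
  rw [ibpOp_ibpOp D L E F i j k l x hd, ibpOp_ibpOp D L E F j i l k x hd, hs.eq]
  ring
end

section
/- Every linear combination of IBP identities can be moved to the corner point (1,…,1) by shift operators: for every N : ℕ and every point n : Fin N → ℤ, there exist a linear operator W on V that is a finite composition of operators from the set {A_α : α : Fin N} ∪ {B_α : α : Fin N} and a nonzero real constant c such that for every f : (Fin N → ℤ) → ℝ, (W f)(𝟙) = c · f(n), where 𝟙 : Fin N → ℤ is the constant function 1. -/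
/-- The operator `A_α`: `(A_α f)(n) = n_α · f(n + e_α)`. -/
def Aop (N : ℕ) (α : Fin N) : ((Fin N → ℤ) → ℝ) →ₗ[ℝ] ((Fin N → ℤ) → ℝ) where
  toFun f := fun n => (n α : ℝ) * f (n + Pi.single α 1)
  map_add' f g := by funext n; simp [mul_add]
  map_smul' c f := by funext n; simp; ring

/-- The operator `B_α`: `(B_α f)(n) = f(n − e_α)`. -/
def Bop (N : ℕ) (α : Fin N) : ((Fin N → ℤ) → ℝ) →ₗ[ℝ] ((Fin N → ℤ) → ℝ) where
  toFun f := fun n => f (n - Pi.single α 1)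
  map_add' f g := by funext n; simp
  map_smul' c f := by funext n; simp

/-- Some finite composition of the shift operators, evaluated at `m`, is a nonzero multiple of
evaluation at `n`. -/
def ShiftReach {N : ℕ} (m n : Fin N → ℤ) : Prop :=
  ∃ (ops : List (((Fin N → ℤ) → ℝ) →ₗ[ℝ] ((Fin N → ℤ) → ℝ))) (c : ℝ),
    (∀ W ∈ ops, (∃ α, W = Aop N α) ∨ (∃ α, W = Bop N α)) ∧
    c ≠ 0 ∧
    ∀ f : (Fin N → ℤ) → ℝ, (ops.prod f) m = c * f n

namespace ShiftReach

variable {N : ℕ} {m k n : Fin N → ℤ}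

theorem refl (m : Fin N → ℤ) : ShiftReach m m :=
  ⟨[], 1, by simp, one_ne_zero, by simp⟩

theorem trans (h₁ : ShiftReach m k) (h₂ : ShiftReach k n) : ShiftReach m n := by
  obtain ⟨l₁, c₁, hl₁, hc₁, h₁⟩ := h₁
  obtain ⟨l₂, c₂, hl₂, hc₂, h₂⟩ := h₂
  refine ⟨l₁ ++ l₂, c₁ * c₂, fun W hW => ?_, mul_ne_zero hc₁ hc₂, fun f => ?_⟩
  · exact (List.mem_append.1 hW).elim (hl₁ W) (hl₂ W)
  · rw [List.prod_append, Module.End.mul_apply, h₁, h₂, mul_assoc]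

theorem add_single {α : Fin N} (h : m α ≠ 0) : ShiftReach m (m + Pi.single α 1) :=
  ⟨[Aop N α], m α, by simp, Int.cast_ne_zero.2 h, by simp [Aop]⟩

theorem sub_single (m : Fin N → ℤ) (α : Fin N) : ShiftReach m (m - Pi.single α 1) :=
  ⟨[Bop N α], 1, by simp, one_ne_zero, by simp [Bop]⟩

theorem update {α : Fin N} (h : 0 < m α) (j : ℤ) :
    ShiftReach m (Function.update m α j) := by
  have base : ShiftReach m (Function.update m α (m α)) := by
    rw [Function.update_eq_self]
    exact refl m
  rcases le_total (m α) j with hj | hj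
  · induction j, hj using Int.leInduction with
    | base => exact base
    | succ j hj ih =>
      have hj₀ : Function.update m α j α ≠ 0 := by
        rw [Function.update_self]
        lia
      convert ih.trans (add_single hj₀) using 1
      ext i
      by_cases hi : i = α
      · subst hi
        simp
      · simp [hi]
  · induction j, hj using Int.leInductionDown with
    | base => exact base
    | pred j hj ih =>
      convert ih.trans (sub_single _ α) using 1
      ext i
      by_cases hi : i = α
      · subst hi
        simp
      · simp [hi]

theorem piecewise (h : ∀ i, 0 < m i) (n : Fin N → ℤ) (s : Finset (Fin N)) :
    ShiftReach m (s.piecewise n m) := by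
  induction s using Finset.induction_on with
  | empty =>
    rw [Finset.piecewise_empty]
    exact refl m
  | insert a s ha ih =>
    rw [Finset.piecewise_insert]
    exact ih.trans (update (by simpa [ha] using h a) _)

end ShiftReach

/-- Any point `n ∈ ℤ^N` can be reached from the corner point `(1,…,1)` by a
finite composition `W` of the shift operators `A_α`, `B_α`, up to a nonzero
constant: `(W f)(1,…,1) = c · f(n)` for all `f`. -/
theorem shift_to_corner (N : ℕ) (n : Fin N → ℤ) :
    ∃ (ops : List (((Fin N → ℤ) → ℝ) →ₗ[ℝ] ((Fin N → ℤ) → ℝ))) (c : ℝ),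
      (∀ W ∈ ops, (∃ α, W = Aop N α) ∨ (∃ α, W = Bop N α)) ∧
      c ≠ 0 ∧
      ∀ f : (Fin N → ℤ) → ℝ, (ops.prod f) (fun _ => 1) = c * f n := by
  have h := ShiftReach.piecewise (m := fun _ => 1) (fun _ => one_pos) n Finset.univ
  rwa [Finset.piecewise_univ] at h
end
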